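/- Let A_n ⊆ L_n be the set of coatoms of L_n. If x ∈ L_n can be expressed as the meet (set intersection) of a subset S ⊆ A_n, then S is uniquely determined by x: whenever S, S' ⊆ A_n satisfy ⋀_{s∈S} s = ⋀_{s∈S'} s = x, one has S = S'. -/

import Mathlib

open scoped Classical

/-- An arithmetic progression of integers: a finite set of the form
`{a, a+r, ..., a+(k-1)r}` with `a : ℤ`, `r ≥ 1` and `k ≥ 0` (so the empty set and all
singletons are arithmetic progressions). -/
def IsAP (s : Finset ℤ) : Prop :=
  ∃ (a r : ℤ) (k : ℕ), 1 ≤ r ∧ s = (Finset.range k).image (fun i => a + (i : ℤ) * r)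

/-- The number `p_{nk}` of arithmetic progressions of cardinality `k` contained in `{1,…,n}`. -/
noncomputable def numAP (n k : ℕ) : ℕ :=
  ((Finset.Icc (1:ℤ) (n:ℤ)).powerset.filter (fun s => IsAP s ∧ s.card = k)).card

/-- The Möbius function of the poset of arithmetic progressions ordered by inclusion,
defined by `μ(x,x) = 1` and `μ(x,y) = -∑_{x ≤ z < y} μ(x,z)`, where `z` ranges over
arithmetic progressions with `x ⊆ z ⊂ y`.  (For `x ⊆ y ⊆ {1,…,n}`, all arithmetic
progressions `z` with `x ⊆ z ⊂ y` automatically lie in `L_n`, so this is the Möbius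
function of any interval `[x, y]` of the lattice `L_n`.) -/
noncomputable def apMu (x y : Finset ℤ) : ℤ :=
  if x = y then 1
  else - ∑ z ∈ (y.powerset.filter (fun z => IsAP z ∧ x ⊆ z ∧ z ≠ y)).attach, apMu x z.1
termination_by y.card
decreasing_by
  rename_i z
  have hz := z.2
  rw [Finset.mem_filter, Finset.mem_powerset] at hz
  exact Finset.card_lt_card (lt_of_le_of_ne hz.1 hz.2.2.2)

/-- The join of `a` and `b` in the lattice of arithmetic progressions contained in `t`:
the intersection of all arithmetic progressions contained in `t` that contain `a ∪ b`,
i.e. the smallest such progression. -/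
noncomputable def apJoin (t a b : Finset ℤ) : Finset ℤ :=
  t.filter (fun v => ∀ z : Finset ℤ, IsAP z → z ⊆ t → a ∪ b ⊆ z → v ∈ z)

/-- The meet (intersection) of a finite family `S` of subsets of the top element `t`;
the meet of the empty family is `t` itself. -/
def apMeet (t : Finset ℤ) (S : Finset (Finset ℤ)) : Finset ℤ :=
  S.fold (· ⊓ ·) t id

/-- `x` is a coatom of the lattice `L_n` of arithmetic progressions contained in
`{1,…,n}`: an element distinct from the maximum `{1,…,n}` with no element strictly
between it and the maximum. -/
def IsCoatomIn (n : ℕ) (x : Finset ℤ) : Prop :=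
  IsAP x ∧ x ⊆ Finset.Icc (1:ℤ) (n:ℤ) ∧ x ≠ Finset.Icc (1:ℤ) (n:ℤ) ∧
    ∀ y : Finset ℤ, IsAP y → y ⊆ Finset.Icc (1:ℤ) (n:ℤ) → x ⊂ y → y = Finset.Icc (1:ℤ) (n:ℤ)

/-- `y` is covered by `top` in the poset of arithmetic progressions: `y < top` and there
is no arithmetic progression strictly between them. -/
def CoveredIn (top y : Finset ℤ) : Prop :=
  IsAP y ∧ y ⊂ top ∧ ¬ ∃ z : Finset ℤ, IsAP z ∧ y ⊂ z ∧ z ⊂ top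

/-- `c` is a maximal chain in the lattice `L_n` of arithmetic progressions contained
in `{1,…,n}`: a chain (under inclusion) of elements of `L_n` to which no further
element of `L_n` can be added. -/
def IsMaxChainIn (n : ℕ) (c : Finset (Finset ℤ)) : Prop :=
  (∀ s ∈ c, IsAP s ∧ s ⊆ Finset.Icc (1:ℤ) (n:ℤ)) ∧
  IsChain (· ⊆ ·) (↑c : Set (Finset ℤ)) ∧
  ∀ z : Finset ℤ, IsAP z → z ⊆ Finset.Icc (1:ℤ) (n:ℤ) →
    IsChain (· ⊆ ·) (insert z (↑c : Set (Finset ℤ))) → z ∈ c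

/-- The number `b_{nk}` of chains of length `k` (i.e. totally ordered subsets with `k+1`
elements) in `L_n` that contain both `∅` and `{1,…,n}`. -/
noncomputable def numChains (n k : ℕ) : ℕ :=
  (((Finset.Icc (1:ℤ) (n:ℤ)).powerset.filter IsAP).powerset.filter
    (fun c : Finset (Finset ℤ) => c.card = k + 1 ∧ ∅ ∈ c ∧ Finset.Icc (1:ℤ) (n:ℤ) ∈ c ∧
      IsChain (· ⊆ ·) (↑c : Set (Finset ℤ)))).card

theorem mem_apMeet {t : Finset ℤ} {S : Finset (Finset ℤ)} {x : ℤ} :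
    x ∈ apMeet t S ↔ x ∈ t ∧ ∀ s ∈ S, x ∈ s := by
  unfold apMeet
  induction S using Finset.induction_on with
  | empty => simp
  | insert a S ha ih =>
    rw [Finset.fold_insert ha, Finset.inf_eq_inter, Finset.mem_inter, ih]
    simp only [id, Finset.forall_mem_insert]
    tauto

theorem isAP_iff {s : Finset ℤ} :
    IsAP s ↔ ∃ (a r : ℤ) (k : ℕ), 1 ≤ r ∧ ∀ x, x ∈ s ↔ ∃ i : ℕ, i < k ∧ a + (i : ℤ) * r = x := by
  have key (a r : ℤ) (k : ℕ) (x : ℤ) :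
      x ∈ (Finset.range k : Finset ℤ).image (fun i => a + (i : ℤ) * r) ↔
        ∃ i : ℕ, i < k ∧ a + (i : ℤ) * r = x := by
    simp
  simp only [IsAP, Finset.ext_iff, key]

theorem isAP_Icc (a b : ℤ) : IsAP (Finset.Icc a b) := by
  refine isAP_iff.2 ⟨a, 1, (b + 1 - a).toNat, le_rfl, fun x => ?_⟩
  rw [Finset.mem_Icc]
  constructor
  · rintro ⟨h₁, h₂⟩
    exact ⟨(x - a).toNat, by omega, by omega⟩
  · rintro ⟨i, hi, rfl⟩
    omega

/-- The elements of `{1,…,n}` congruent to `1` modulo `d`. -/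
noncomputable def oneModAP (n d : ℕ) : Finset ℤ :=
  (Finset.Icc (1 : ℤ) n).filter fun x => (d : ℤ) ∣ x - 1

theorem mem_oneModAP {n d : ℕ} {x : ℤ} :
    x ∈ oneModAP n d ↔ (1 ≤ x ∧ x ≤ n) ∧ (d : ℤ) ∣ x - 1 := by
  simp [oneModAP]

theorem isAP_oneModAP {m d : ℕ} (hd : 0 < d) (hdvd : d ∣ m) : IsAP (oneModAP (m + 1) d) := by
  obtain ⟨k, rfl⟩ := hdvd
  refine isAP_iff.2 ⟨1, d, k + 1, by omega, fun x => ?_⟩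
  rw [mem_oneModAP]
  have hd' : (0 : ℤ) < d := by exact_mod_cast hd
  constructor
  · rintro ⟨⟨h₁, h₂⟩, j, hj⟩
    push_cast at h₂
    have hj₀ : 0 ≤ j := by nlinarith
    have hjk : j ≤ k := by
      by_contra! hlt
      nlinarith
    lift j to ℕ using hj₀
    exact ⟨j, by omega, by linarith [mul_comm (d : ℤ) j]⟩
  · rintro ⟨i, hi, rfl⟩
    have hik : (i : ℤ) ≤ k := by omega
    refine ⟨⟨by nlinarith [Int.natCast_nonneg i], ?_⟩, i, by ring⟩
    push_cast
    nlinarith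

theorem IsCoatomIn.eq_of_subset {n : ℕ} {c y : Finset ℤ} (hc : IsCoatomIn n c) (hy : IsAP y)
    (hyn : y ⊆ Finset.Icc (1 : ℤ) n) (hne : y ≠ Finset.Icc (1 : ℤ) n) (hcy : c ⊆ y) : c = y := by
  by_contra h
  exact hne (hc.2.2.2 y hy hyn (hcy.ssubset_of_ne h))

theorem IsCoatomIn.pos {n : ℕ} {c : Finset ℤ} (hc : IsCoatomIn n c) : 0 < n := by
  rcases Nat.eq_zero_or_pos n with rfl | h
  · obtain ⟨-, hsub, hne, -⟩ := hc
    simp_all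
  · exact h

theorem IsCoatomIn.eq_of_last_notMem {n : ℕ} {c : Finset ℤ} (hc : IsCoatomIn n c)
    (h : (n : ℤ) ∉ c) : c = Finset.Icc (1 : ℤ) (n - 1) := by
  have hn := hc.pos
  refine hc.eq_of_subset (isAP_Icc _ _) (Finset.Icc_subset_Icc_right (by omega)) ?_ ?_
  · intro heq
    have : (n : ℤ) ∈ Finset.Icc (1 : ℤ) (n - 1) := heq ▸ Finset.mem_Icc.2 ⟨by omega, le_rfl⟩
    rw [Finset.mem_Icc] at this
    omega
  · intro x hx
    have := Finset.mem_Icc.1 (hc.2.1 hx)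
    have hxn : x ≠ n := by rintro rfl; exact h hx
    exact Finset.mem_Icc.2 (by omega)

theorem IsCoatomIn.eq_of_one_notMem {n : ℕ} {c : Finset ℤ} (hc : IsCoatomIn n c)
    (h : (1 : ℤ) ∉ c) : c = Finset.Icc (2 : ℤ) n := by
  have hn := hc.pos
  refine hc.eq_of_subset (isAP_Icc _ _) (Finset.Icc_subset_Icc_left (by omega)) ?_ ?_
  · intro heq
    have : (1 : ℤ) ∈ Finset.Icc (2 : ℤ) n := heq ▸ Finset.mem_Icc.2 ⟨le_rfl, by omega⟩
    rw [Finset.mem_Icc] at this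
    omega
  · intro x hx
    have := Finset.mem_Icc.1 (hc.2.1 hx)
    have hx1 : x ≠ 1 := by rintro rfl; exact h hx
    exact Finset.mem_Icc.2 (by omega)

/-- A coatom containing both endpoints is the residue class of `1` modulo a prime divisor
of `n - 1`. -/
theorem IsCoatomIn.exists_prime {m : ℕ} {c : Finset ℤ} (hc : IsCoatomIn (m + 1) c)
    (h1 : (1 : ℤ) ∈ c) (hlast : ((m + 1 : ℕ) : ℤ) ∈ c) :
    0 < m ∧ ∃ p : ℕ, p.Prime ∧ p ∣ m ∧ c = oneModAP (m + 1) p := by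
  have hm : 0 < m := by
    by_contra! h0
    obtain rfl : m = 0 := by omega
    refine hc.2.2.1 (hc.2.1.antisymm fun x hx => ?_)
    rw [Finset.mem_Icc] at hx
    obtain rfl : x = 1 := by omega
    exact h1
  refine ⟨hm, ?_⟩
  obtain ⟨a, r, k, hr, mem_c⟩ := isAP_iff.1 hc.1
  obtain ⟨i, hi, hi1⟩ := (mem_c _).1 h1
  obtain ⟨j, hj, hjn⟩ := (mem_c _).1 hlast
  lift r to ℕ using by omega
  have hr1 : r ≠ 1 := by
    rintro rfl
    refine hc.2.2.1 (hc.2.1.antisymm fun x hx => (mem_c x).2 ⟨(x - a).toNat, ?_, ?_⟩) <;>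
    · rw [Finset.mem_Icc] at hx
      push_cast at *
      omega
  have hdvd : ∀ x ∈ c, (r : ℤ) ∣ x - 1 := by
    intro x hx
    obtain ⟨l, -, rfl⟩ := (mem_c x).1 hx
    exact ⟨l - i, by linear_combination hi1⟩
  obtain ⟨p, hp, hpr⟩ := Nat.exists_prime_and_dvd hr1
  have hpr' : (p : ℤ) ∣ r := by exact_mod_cast hpr
  have hpm : p ∣ m := by
    have := hpr'.trans (hdvd _ hlast)
    push_cast at this
    rw [add_sub_cancel_right] at this
    exact_mod_cast this
  refine ⟨p, hp, hpm, hc.eq_of_subset (isAP_oneModAP hp.pos hpm) (Finset.filter_subset _ _) ?_ ?_⟩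
  · intro heq
    have h2 : (2 : ℤ) ∈ oneModAP (m + 1) p := heq ▸ Finset.mem_Icc.2 (by omega)
    have h3 := (mem_oneModAP.1 h2).2
    have : p ∣ 1 := Int.natCast_dvd_natCast.1 (by simpa using h3)
    exact hp.one_lt.ne' (Nat.dvd_one.1 this)
  · exact fun x hx => mem_oneModAP.2 ⟨Finset.mem_Icc.1 (hc.2.1 hx), hpr'.trans (hdvd x hx)⟩

/-- Every coatom misses some element of `{1,…,n}` that lies in all the other coatoms. -/
theorem IsCoatomIn.exists_witness {n : ℕ} {c : Finset ℤ} (hc : IsCoatomIn n c) :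
    ∃ w ∈ Finset.Icc (1 : ℤ) n, w ∉ c ∧ ∀ d, IsCoatomIn n d → w ∉ d → d = c := by
  obtain ⟨m, rfl⟩ := Nat.exists_eq_add_one.2 hc.pos
  by_cases hlast : ((m + 1 : ℕ) : ℤ) ∈ c
  swap
  · exact ⟨_, Finset.mem_Icc.2 (by omega), hlast, fun d hd hwd =>
      (hd.eq_of_last_notMem hwd).trans (hc.eq_of_last_notMem hlast).symm⟩
  by_cases h1 : (1 : ℤ) ∈ c
  swap
  · exact ⟨_, Finset.mem_Icc.2 (by omega), h1, fun d hd hwd =>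
      (hd.eq_of_one_notMem hwd).trans (hc.eq_of_one_notMem h1).symm⟩
  obtain ⟨hm, p, hp, hpm, rfl⟩ := hc.exists_prime h1 hlast
  obtain ⟨a, v, hpv, hmv⟩ := Nat.exists_eq_pow_mul_and_not_dvd hm.ne' p hp.ne_one
  have hv0 : 0 < v := Nat.pos_of_ne_zero (by rintro rfl; simp at hpv)
  have hvm : v < m := (Nat.le_of_dvd hm ⟨p ^ a, by rw [hmv, mul_comm]⟩).lt_of_ne
    (by rintro rfl; exact hpv hpm)
  have hdvd : ∀ q : ℕ, (q : ℤ) ∣ ((v : ℤ) + 1) - 1 ↔ q ∣ v := fun q => by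
    rw [add_sub_cancel_right, Int.natCast_dvd_natCast]
  refine ⟨v + 1, Finset.mem_Icc.2 (by omega), fun h => hpv ((hdvd p).1 (mem_oneModAP.1 h).2), ?_⟩
  intro d hd hwd
  have hdlast : ((m + 1 : ℕ) : ℤ) ∈ d := by
    by_contra h
    rw [hd.eq_of_last_notMem h, Finset.mem_Icc] at hwd
    omega
  have hd1 : (1 : ℤ) ∈ d := by
    by_contra h
    rw [hd.eq_of_one_notMem h, Finset.mem_Icc] at hwd
    omega
  obtain ⟨-, q, hq, hqm, rfl⟩ := hd.exists_prime hd1 hdlast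
  have hqv : ¬ q ∣ v := fun h => hwd (mem_oneModAP.2 ⟨by omega, (hdvd q).2 h⟩)
  rw [hmv] at hqm
  have hqp : q ∣ p := hq.dvd_of_dvd_pow ((hq.dvd_mul.1 hqm).resolve_right hqv)
  rw [(Nat.prime_dvd_prime_iff_eq hq hp).1 hqp]

theorem subset_of_apMeet_subset {n : ℕ} {S S' : Finset (Finset ℤ)}
    (hS : ∀ s ∈ S, IsCoatomIn n s) (hS' : ∀ s ∈ S', IsCoatomIn n s)
    (h : apMeet (Finset.Icc (1 : ℤ) n) S' ⊆ apMeet (Finset.Icc (1 : ℤ) n) S) : S ⊆ S' := by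
  intro c hc
  obtain ⟨w, hw, hwc, huniq⟩ := (hS c hc).exists_witness
  by_contra hcS'
  refine hwc ((mem_apMeet.1 (h (mem_apMeet.2 ⟨hw, fun d hd => ?_⟩))).2 c hc)
  by_contra hwd
  exact hcS' (huniq d (hS' d hd) hwd ▸ hd)

/-- If `x ∈ L_n` is a meet (intersection) of a subset `S` of the set of coatoms of
`L_n` (where the meet of the empty family is `[n]`), then `S` is uniquely determined
by `x`. -/
theorem meet_of_coatoms_unique (n : ℕ) (S S' : Finset (Finset ℤ))
    (hS : ∀ s ∈ S, IsCoatomIn n s) (hS' : ∀ s ∈ S', IsCoatomIn n s)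
    (h : apMeet (Finset.Icc (1:ℤ) (n:ℤ)) S = apMeet (Finset.Icc (1:ℤ) (n:ℤ)) S') :
    S = S' := by
  exact (subset_of_apMeet_subset hS hS' h.ge).antisymm (subset_of_apMeet_subset hS' hS h.le)
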